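/- Let Φ : 𝒫⁺ → ℝ be a sublinear function and q ∈ 𝒫⁺. Then Φ has a 𝒫-integrable subgradient at q if and only if there exists q* ∈ ℒ(𝒫) such that p·q* ≤ Φ′₊(p,q) for all p ∈ 𝒫⁺, with equality for p = q. -/

import Mathlib

set_option linter.unusedSectionVars false
open MeasureTheory Set Filter Topology

variable {Ω : Type*} [MeasurableSpace Ω]

/-- `P` is a prediction set with respect to `μ`: a convex set of probability
densities on `Ω`. -/
def IsPredictionSet (μ : Measure Ω) (P : Set (Ω → ℝ)) : Prop :=
  Convex ℝ P ∧ ∀ p ∈ P, Measurable p ∧ (∀ x, 0 ≤ p x) ∧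
    Integrable p μ ∧ ∫ x, p x ∂μ = 1

/-- The prediction cone `𝒫⁺ = {λ p : λ > 0, p ∈ 𝒫}`. -/
def predCone (P : Set (Ω → ℝ)) : Set (Ω → ℝ) :=
  {f | ∃ c : ℝ, 0 < c ∧ ∃ p ∈ P, f = c • p}

/-- `ℒ(𝒫)`: the `𝒫`-integrable functions. -/
def PIntegrable (μ : Measure Ω) (P : Set (Ω → ℝ)) (f : Ω → ℝ) : Prop :=
  Measurable f ∧ ∀ p ∈ P, Integrable (fun x => |f x| * p x) μ

/-- The pairing `p · f = ∫ f p dμ`. -/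
noncomputable def pairing (μ : Measure Ω) (p f : Ω → ℝ) : ℝ :=
  ∫ x, f x * p x ∂μ

/-- `Φ` is (positively) 1-homogeneous and subadditive on the cone `cone`. -/
def SublinearOn (cone : Set (Ω → ℝ)) (Φ : (Ω → ℝ) → ℝ) : Prop :=
  (∀ p ∈ cone, ∀ c : ℝ, 0 < c → Φ (c • p) = c * Φ p) ∧
  ∀ f ∈ cone, ∀ g ∈ cone, Φ (f + g) ≤ Φ f + Φ g

/-- `p` and `q` are positively collinear. -/
def PosCollinear (p q : Ω → ℝ) : Prop := ∃ c : ℝ, 0 < c ∧ p = c • q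

/-- `𝒟(q)`: the set of directions from `q` into `𝒫⁺`. -/
def dirSet (P : Set (Ω → ℝ)) (q : Ω → ℝ) : Set (Ω → ℝ) :=
  {p | p ∈ Submodule.span ℝ P ∧ ∃ ε : ℝ, 0 < ε ∧ q + ε • p ∈ predCone P}

/-- `𝒪(q) = 𝒟(q) ∩ (−𝒟(q))`. -/
def oSet (P : Set (Ω → ℝ)) (q : Ω → ℝ) : Set (Ω → ℝ) :=
  {p | p ∈ dirSet P q ∧ -p ∈ dirSet P q}

/-- The right directional derivative `Φ′₊(p,q)` of a sublinear `Φ` at `q` along `p`,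
taken in `ℝ ∪ {−∞}` (for sublinear `Φ` the limit of slopes as `t → 0⁺` exists and
equals the infimum of the slopes, which is how it is expressed here). -/
noncomputable def rderiv (P : Set (Ω → ℝ)) (Φ : (Ω → ℝ) → ℝ) (q p : Ω → ℝ) : EReal :=
  ⨅ t : {t : ℝ // 0 < t ∧ q + t • p ∈ predCone P},
    (((Φ (q + (t : ℝ) • p) - Φ q) / (t : ℝ) : ℝ) : EReal)

lemma predCone_subset_span (P : Set (Ω → ℝ)) :
    predCone P ⊆ (Submodule.span ℝ P : Set (Ω → ℝ)) := by
  rintro f ⟨c, hc, p, hp, rfl⟩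
  exact Submodule.smul_mem _ _ (Submodule.subset_span hp)

lemma smul_mem_predCone {P : Set (Ω → ℝ)} {p : Ω → ℝ} (hp : p ∈ predCone P) {c : ℝ}
    (hc : 0 < c) : c • p ∈ predCone P := by
  obtain ⟨d, hd, r, hr, rfl⟩ := hp
  exact ⟨c * d, mul_pos hc hd, r, hr, by rw [smul_smul]⟩

lemma add_mem_predCone {P : Set (Ω → ℝ)} (hP : Convex ℝ P) {f g : Ω → ℝ}
    (hf : f ∈ predCone P) (hg : g ∈ predCone P) : f + g ∈ predCone P := by
  obtain ⟨a, ha, p, hp, rfl⟩ := hf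
  obtain ⟨b, hb, r, hr, rfl⟩ := hg
  have hab : 0 < a + b := add_pos ha hb
  refine ⟨a + b, hab, (a / (a + b)) • p + (b / (a + b)) • r,
    hP hp hr (by positivity) (by positivity) (by field_simp), ?_⟩
  rw [smul_add, smul_smul, smul_smul, mul_div_cancel₀ _ hab.ne', mul_div_cancel₀ _ hab.ne']

lemma PIntegrable.integrable_mul {μ : Measure Ω} {P : Set (Ω → ℝ)}
    (hP : IsPredictionSet μ P) {g : Ω → ℝ} (hg : PIntegrable μ P g) {p : Ω → ℝ}
    (hp : p ∈ predCone P) : Integrable (fun x => g x * p x) μ := by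
  obtain ⟨c, -, r, hr, rfl⟩ := hp
  obtain ⟨hr_meas, hr_nonneg, -⟩ := hP.2 r hr
  have h : Integrable (fun x => g x * r x) μ :=
    (hg.2 r hr).mono' (hg.1.mul hr_meas).aestronglyMeasurable <| .of_forall fun x => by
      rw [Real.norm_eq_abs, abs_mul, abs_of_nonneg (hr_nonneg x)]
  refine (h.const_mul c).congr (.of_forall fun x => ?_)
  simp only [Pi.smul_apply, smul_eq_mul]
  ring

lemma pairing_add_smul {μ : Measure Ω} {P : Set (Ω → ℝ)} (hP : IsPredictionSet μ P)
    {g : Ω → ℝ} (hg : PIntegrable μ P g) {q p : Ω → ℝ} (hq : q ∈ predCone P)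
    (hp : p ∈ predCone P) (t : ℝ) :
    pairing μ (q + t • p) g = pairing μ q g + t * pairing μ p g := by
  unfold pairing
  rw [← integral_const_mul, ← integral_add (hg.integrable_mul hP hq)
    ((hg.integrable_mul hP hp).const_mul t)]
  refine integral_congr_ae (.of_forall fun x => ?_)
  simp only [Pi.add_apply, Pi.smul_apply, smul_eq_mul]
  ring

/-- By Euler's identity the derivative of a sublinear function at `q` along `q` is its value. -/
lemma rderiv_self {P : Set (Ω → ℝ)} {Φ : (Ω → ℝ) → ℝ} (hΦ : SublinearOn (predCone P) Φ)
    {q : Ω → ℝ} (hq : q ∈ predCone P) : rderiv P Φ q q = (Φ q : EReal) := by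
  have add_smul_self (t : ℝ) : q + t • q = (1 + t) • q := by rw [add_smul, one_smul]
  have slope (t : ℝ) (ht : 0 < t) : (Φ (q + t • q) - Φ q) / t = Φ q := by
    rw [add_smul_self, hΦ.1 q hq (1 + t) (by positivity)]
    field_simp
    ring
  have : Nonempty {t : ℝ // 0 < t ∧ q + t • q ∈ predCone P} :=
    ⟨1, one_pos, by rw [add_smul_self]; exact smul_mem_predCone hq (by norm_num)⟩
  exact (iInf_congr fun t : {t : ℝ // 0 < t ∧ q + t • q ∈ predCone P} =>
    congrArg Real.toEReal (slope t.1 t.2.1)).trans iInf_const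

/-- The derivative of a sublinear function is dominated by the function. -/
lemma rderiv_le {P : Set (Ω → ℝ)} (hP : Convex ℝ P) {Φ : (Ω → ℝ) → ℝ}
    (hΦ : SublinearOn (predCone P) Φ) {q p : Ω → ℝ} (hq : q ∈ predCone P)
    (hp : p ∈ predCone P) : rderiv P Φ q p ≤ (Φ p : EReal) := by
  have hmem : q + (1 : ℝ) • p ∈ predCone P := by
    rw [one_smul]; exact add_mem_predCone hP hq hp
  refine (iInf_le _ (⟨1, one_pos, hmem⟩ : {t : ℝ // 0 < t ∧ q + t • p ∈ predCone P})).trans ?_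
  rw [EReal.coe_le_coe_iff]
  simp only [one_smul, div_one]
  linarith [hΦ.2 q hq p hp]

/-- A sublinear `Φ` has a `𝒫`-integrable subgradient at `q ∈ 𝒫⁺`
iff there is `g ∈ ℒ(𝒫)` with `p·g ≤ Φ′₊(p,q)` for all `p ∈ 𝒫⁺` and equality at `p = q`. -/
theorem exists_PIntegrable_subgradient_iff
    (μ : Measure Ω) (P : Set (Ω → ℝ)) (hP : IsPredictionSet μ P)
    (Φ : (Ω → ℝ) → ℝ) (hΦ : SublinearOn (predCone P) Φ)
    (q : Ω → ℝ) (hq : q ∈ predCone P) :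
    (∃ g : Ω → ℝ, PIntegrable μ P g ∧
        (∀ p ∈ predCone P, pairing μ p g ≤ Φ p) ∧ pairing μ q g = Φ q) ↔
    (∃ g : Ω → ℝ, PIntegrable μ P g ∧
        (∀ p ∈ predCone P, ((pairing μ p g : ℝ) : EReal) ≤ rderiv P Φ q p) ∧
        ((pairing μ q g : ℝ) : EReal) = rderiv P Φ q q) := by
  constructor
  · rintro ⟨g, hg, hle, heq⟩
    refine ⟨g, hg, fun p hp => le_iInf fun ⟨t, ht, hmem⟩ => ?_, ?_⟩
    · rw [EReal.coe_le_coe_iff, le_div_iff₀ ht]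
      linarith [hle _ hmem, pairing_add_smul hP hg hq hp t]
    · rw [rderiv_self hΦ hq, heq]
  · rintro ⟨g, hg, hle, heq⟩
    rw [rderiv_self hΦ hq, EReal.coe_eq_coe_iff] at heq
    exact ⟨g, hg, fun p hp =>
      EReal.coe_le_coe_iff.1 ((hle p hp).trans (rderiv_le hP.1 hΦ hq hp)), heq⟩
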